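/- Fix n ∈ ℕ, d ≥ 2, and a compact basic semialgebraic set X ⊆ ℝ^m whose quadratic module Q(X) is Archimedean. Identifying degree-d n-player polynomial games over X with their coefficient vectors in ℝ^M, the set of games that are monotone over X (SJ_G(x) ⪯ 0 for all x ∈ X) but not SOS-monotone (there is no ℓ ∈ ℕ with −yᵀ SJ_G(x) y ∈ Q_ℓ(X × B)) has Lebesgue measure zero in ℝ^M. -/

import Mathlib

open MvPolynomial Finset

noncomputable section

/-- `p` is a sum of squares of polynomials. -/
def IsSOS {σ : Type*} (p : MvPolynomial σ ℝ) : Prop :=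
  ∃ (k : ℕ) (q : Fin k → MvPolynomial σ ℝ), p = ∑ i, q i ^ 2

/-- Membership in the quadratic module generated by the inequality polynomials `g`
and the equality polynomials `h`. -/
def InQM {σ ιg ιh : Type*} [Fintype ιg] [Fintype ιh]
    (g : ιg → MvPolynomial σ ℝ) (h : ιh → MvPolynomial σ ℝ)
    (p : MvPolynomial σ ℝ) : Prop :=
  ∃ (s0 : MvPolynomial σ ℝ) (s : ιg → MvPolynomial σ ℝ) (q : ιh → MvPolynomial σ ℝ),
    IsSOS s0 ∧ (∀ j, IsSOS (s j)) ∧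
      p = s0 + ∑ j, g j * s j + ∑ j, h j * q j

/-- Membership in the degree-`ℓ` truncation of the quadratic module: all the SOS
multipliers and the polynomial multipliers have degree at most `ℓ`. -/
def InQMdeg {σ ιg ιh : Type*} [Fintype ιg] [Fintype ιh]
    (ℓ : ℕ) (g : ιg → MvPolynomial σ ℝ) (h : ιh → MvPolynomial σ ℝ)
    (p : MvPolynomial σ ℝ) : Prop :=
  ∃ (s0 : MvPolynomial σ ℝ) (s : ιg → MvPolynomial σ ℝ) (q : ιh → MvPolynomial σ ℝ),
    IsSOS s0 ∧ (∀ j, IsSOS (s j)) ∧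
      s0.totalDegree ≤ ℓ ∧ (∀ j, (s j).totalDegree ≤ ℓ) ∧ (∀ j, (q j).totalDegree ≤ ℓ) ∧
      p = s0 + ∑ j, g j * s j + ∑ j, h j * q j

/-- The basic semialgebraic set `{x | g j x ≥ 0 for all j, h j x = 0 for all j}`. -/
def semialgSet {m : ℕ} {ιg ιh : Type*} (g : ιg → MvPolynomial (Fin m) ℝ)
    (h : ιh → MvPolynomial (Fin m) ℝ) : Set (Fin m → ℝ) :=
  {x | (∀ j, 0 ≤ eval x (g j)) ∧ ∀ j, eval x (h j) = 0}
/-- The `j`-th component of the pseudogradient of the game with payoffs `u`, where the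
variable `j` belongs to player `π j`. -/
def pseudoGrad {m n : ℕ} (π : Fin m → Fin n) (u : Fin n → MvPolynomial (Fin m) ℝ)
    (j : Fin m) : MvPolynomial (Fin m) ℝ :=
  pderiv j (u (π j))

/-- Entry `(j, k)` of the symmetrized Jacobian `SJ = (J + Jᵀ)/2` of the pseudogradient. -/
def sjac {m n : ℕ} (π : Fin m → Fin n) (u : Fin n → MvPolynomial (Fin m) ℝ)
    (j k : Fin m) : MvPolynomial (Fin m) ℝ :=
  C (1 / 2 : ℝ) * (pderiv k (pseudoGrad π u j) + pderiv j (pseudoGrad π u k))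

/-- The quadratic form `yᵀ SJ(x) y` of the symmetrized Jacobian. -/
def sjForm {m n : ℕ} (π : Fin m → Fin n) (u : Fin n → MvPolynomial (Fin m) ℝ)
    (x y : Fin m → ℝ) : ℝ :=
  ∑ j, ∑ k, y j * y k * eval x (sjac π u j k)
/-- The inequality polynomials of `X`, viewed as polynomials in the variables `(x, y)`. -/
def liftIneq {m : ℕ} {ιg : Type*} (τ : Type*) (g : ιg → MvPolynomial (Fin m) ℝ) :
    ιg → MvPolynomial (Fin m ⊕ τ) ℝ :=
  fun j => rename Sum.inl (g j)

/-- The equality polynomials of `X` together with `1 - yᵀy`, viewed as polynomials in the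
variables `(x, y)`; together with `liftIneq` these define `X × B`. -/
def liftEq {m : ℕ} {ιh : Type*} (τ : Type*) [Fintype τ] (h : ιh → MvPolynomial (Fin m) ℝ) :
    ιh ⊕ Unit → MvPolynomial (Fin m ⊕ τ) ℝ :=
  Sum.elim (fun j => rename Sum.inl (h j)) (fun _ => 1 - ∑ t : τ, X (Sum.inr t) ^ 2)

/-- The polynomial `yᵀ SJ(x) y` in the variables `(x, y)`. -/
def sjFormPoly {m n : ℕ} (π : Fin m → Fin n) (u : Fin n → MvPolynomial (Fin m) ℝ) :
    MvPolynomial (Fin m ⊕ Fin m) ℝ :=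
  ∑ j, ∑ k, X (Sum.inr j) * X (Sum.inr k) * rename Sum.inl (sjac π u j k)
/-- Index set for the monomials of total degree at most `d` in `m` variables: exponent
tuples `e` with `Σ_j e j ≤ d`. -/
abbrev ExpIdx (m d : ℕ) : Type :=
  {e : Fin m → Fin (d + 1) // (∑ j, ((e j : ℕ))) ≤ d}

/-- The polynomial of total degree at most `d` with coefficient vector `c`; this realizes
the identification of degree-`d` payoffs with coefficient vectors in `ℝ^M`. -/
def payoffOf {m : ℕ} (d : ℕ) (c : ExpIdx m d → ℝ) : MvPolynomial (Fin m) ℝ :=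
  ∑ e : ExpIdx m d, C (c e) * ∏ j, X j ^ ((e.1 j : ℕ))

/-- A quadratic module in a commutative `ℝ`-algebra that is Archimedean: every square is bounded
by a real number. -/
structure IsArchQuadraticModule {A : Type*} [CommRing A] [Algebra ℝ A] (Q : Set A) : Prop where
  add_mem : ∀ {a b}, a ∈ Q → b ∈ Q → a + b ∈ Q
  sq_mul_mem : ∀ (a) {b}, b ∈ Q → a ^ 2 * b ∈ Q
  one_mem : (1 : A) ∈ Q
  exists_sub_sq_mem : ∀ a, ∃ N : ℝ, N • (1 : A) - a ^ 2 ∈ Q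

/-- The normalized linear functionals that are nonnegative on `Q`. -/
def stateSet {A : Type*} [CommRing A] [Algebra ℝ A] (Q : Set A) : Set (A → ℝ) :=
  {L | (∀ a b, L (a + b) = L a + L b) ∧ (∀ (r : ℝ) a, L (r • a) = r * L a) ∧ L 1 = 1 ∧
    ∀ q ∈ Q, 0 ≤ L q}

namespace IsArchQuadraticModule

variable {A : Type*} [CommRing A] [Algebra ℝ A] {Q : Set A}

lemma sq_mem (hQ : IsArchQuadraticModule Q) (a : A) : a ^ 2 ∈ Q := by
  simpa using hQ.sq_mul_mem a hQ.one_mem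

lemma zero_mem (hQ : IsArchQuadraticModule Q) : (0 : A) ∈ Q := by
  simpa using hQ.sq_mem 0

lemma smul_mem (hQ : IsArchQuadraticModule Q) {r : ℝ} (hr : 0 ≤ r) {a : A} (ha : a ∈ Q) :
    r • a ∈ Q := by
  have h := hQ.sq_mul_mem (√r • (1 : A)) ha
  rwa [smul_pow, Real.sq_sqrt hr, one_pow, smul_mul_assoc, one_mul] at h

lemma smul_one_mem (hQ : IsArchQuadraticModule Q) {r : ℝ} (hr : 0 ≤ r) : r • (1 : A) ∈ Q :=
  hQ.smul_mem hr hQ.one_mem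

lemma exists_smul_one_sub_mem (hQ : IsArchQuadraticModule Q) (a : A) :
    ∃ N : ℝ, N • (1 : A) - a ∈ Q := by
  obtain ⟨N, hN⟩ := hQ.exists_sub_sq_mem a
  refine ⟨N + 1 / 4, ?_⟩
  convert! hQ.add_mem hN (hQ.sq_mem (a - (1 / 2 : ℝ) • (1 : A))) using 1
  simp only [Algebra.smul_def, map_add, mul_one]
  have h : (algebraMap ℝ A (1 / 4)) = algebraMap ℝ A (1 / 2) ^ 2 := by
    rw [← map_pow]; norm_num
  have h2 : 2 * algebraMap ℝ A (1 / 2) = 1 := by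
    rw [← map_ofNat (algebraMap ℝ A) 2, ← map_mul]; norm_num
  rw [h]
  linear_combination a * h2

lemma mem_of_neg_one_mem (hQ : IsArchQuadraticModule Q) (h1 : (-1 : A) ∈ Q) (a : A) : a ∈ Q := by
  have h := hQ.add_mem (hQ.sq_mem ((1 / 2 : ℝ) • (a + 1)))
    (hQ.sq_mul_mem ((1 / 2 : ℝ) • (a - 1)) h1)
  convert! h using 1
  simp only [Algebra.smul_def]
  have h2 : 2 * algebraMap ℝ A (1 / 2) = 1 := by
    rw [← map_ofNat (algebraMap ℝ A) 2, ← map_mul]; norm_num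
  linear_combination (-(2 * algebraMap ℝ A (1 / 2) + 1) * a) * h2

/-- A point outside an Archimedean quadratic module is separated from it by a state. -/
lemma exists_state_le_zero (hQ : IsArchQuadraticModule Q) {f : A} (hf : f ∉ Q) :
    ∃ L ∈ stateSet Q, L f ≤ 0 := by
  let s : PointedCone ℝ A :=
    { carrier := {a | ∃ q ∈ Q, ∃ r : ℝ, 0 ≤ r ∧ a = q - r • f}
      add_mem' := by
        rintro _ _ ⟨q, hq, r, hr, rfl⟩ ⟨q', hq', r', hr', rfl⟩
        exact ⟨q + q', hQ.add_mem hq hq', r + r', add_nonneg hr hr', by rw [add_smul]; abel⟩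
      zero_mem' := ⟨0, hQ.zero_mem, 0, le_rfl, by simp⟩
      smul_mem' := by
        rintro ⟨c, hc⟩ _ ⟨q, hq, r, hr, rfl⟩
        refine ⟨c • q, hQ.smul_mem hc hq, c * r, mul_nonneg hc hr, ?_⟩
        change c • (q - r • f) = _
        rw [smul_sub, mul_smul] }
  have hQs : ∀ q ∈ Q, q ∈ s := fun q hq ↦ ⟨q, hq, 0, le_rfl, by simp⟩
  have hne : (1 : A) ≠ 0 := fun h ↦ hf <| by
    rw [← mul_one f, h, mul_zero]; exact hQ.zero_mem
  have hneg : ∀ c : ℝ, c • (1 : A) ∈ s → 0 ≤ c := by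
    rintro c ⟨q, hq, r, hr, hc⟩
    by_contra! hc0
    have hrf : r • f = q + (-c) • (1 : A) := by rw [neg_smul, hc]; abel
    rcases hr.eq_or_lt with rfl | hr0
    · refine hf (hQ.mem_of_neg_one_mem ?_ f)
      have := hQ.smul_mem (r := (-c)⁻¹) (by rw [inv_nonneg]; linarith) hq
      have hq' : q = (-c) • (-1 : A) := by
        rw [zero_smul] at hrf
        rw [smul_neg, eq_neg_iff_add_eq_zero, hrf]
      rwa [hq', smul_smul, inv_mul_cancel₀ (by linarith), one_smul] at this
    · have := hQ.smul_mem (inv_nonneg.2 hr)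
        (hQ.add_mem hq (hQ.smul_one_mem (r := -c) (by linarith)))
      rw [← hrf, smul_smul, inv_mul_cancel₀ hr0.ne', one_smul] at this
      exact hf this
  let F : A →ₗ.[ℝ] ℝ := LinearPMap.mkSpanSingleton (σ := RingHom.id ℝ) (1 : A) (1 : ℝ) hne
  have hFval : ∀ (c : ℝ) (h : c • (1 : A) ∈ F.domain), F ⟨c • 1, h⟩ = c := by
    intro c h
    exact (LinearPMap.mkSpanSingleton'_apply _ _ _ _ _).trans (by simp)
  have hmem : ∀ c : ℝ, c • (1 : A) ∈ F.domain := fun c ↦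
    Submodule.mem_span_singleton.2 ⟨c, rfl⟩
  obtain ⟨G, hG, hGs⟩ := riesz_extension s F
    (by
      rintro ⟨x, hx⟩ hxs
      obtain ⟨c, rfl⟩ := Submodule.mem_span_singleton.1 hx
      rw [hFval]
      exact hneg c hxs)
    (by
      intro y
      obtain ⟨N, hN⟩ := hQ.exists_smul_one_sub_mem (-y)
      exact ⟨⟨N • 1, hmem N⟩, hQs _ (by simpa using hN)⟩)
  refine ⟨G, ⟨fun a b ↦ map_add G a b, fun r a ↦ map_smul G r a, ?_, fun q hq ↦ hGs q (hQs q hq)⟩,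
    ?_⟩
  · have h := hG ⟨(1 : ℝ) • 1, hmem 1⟩
    rw [hFval] at h
    simpa using h
  · have h := hGs (-f) ⟨0, hQ.zero_mem, 1, zero_le_one, by simp⟩
    rw [map_neg] at h
    linarith

lemma state_sub {L : A → ℝ} (hL : L ∈ stateSet Q) (a b : A) : L (a - b) = L a - L b := by
  have := hL.1 (a - b) b
  rw [sub_add_cancel] at this
  linarith

lemma isCompact_stateSet (hQ : IsArchQuadraticModule Q) : IsCompact (stateSet Q) := by
  choose N hN using hQ.exists_smul_one_sub_mem
  refine (isCompact_univ_pi fun a ↦ isCompact_Icc (a := -N (-a)) (b := N a)).of_isClosed_subset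
    ?_ ?_
  · have hset : stateSet Q = (⋂ a, ⋂ b, {L : A → ℝ | L (a + b) = L a + L b}) ∩
        ((⋂ r : ℝ, ⋂ a, {L : A → ℝ | L (r • a) = r * L a}) ∩ ({L : A → ℝ | L 1 = 1} ∩
          ⋂ q ∈ Q, {L : A → ℝ | 0 ≤ L q})) := by
      ext L
      simp [stateSet]
    rw [hset]
    refine IsClosed.inter (isClosed_iInter fun a ↦ isClosed_iInter fun b ↦ ?_)
      (IsClosed.inter (isClosed_iInter fun r ↦ isClosed_iInter fun a ↦ ?_)
        (IsClosed.inter ?_ (isClosed_biInter fun q _ ↦ ?_)))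
    · exact isClosed_eq (by fun_prop) (by fun_prop)
    · exact isClosed_eq (by fun_prop) (by fun_prop)
    · exact isClosed_eq (by fun_prop) (by fun_prop)
    · exact isClosed_le (by fun_prop) (by fun_prop)
  · intro L hL a _
    have h1 := hL.2.2.2 _ (hN a)
    have h2 := hL.2.2.2 _ (hN (-a))
    have h3 := hL.2.1 (-1) a
    rw [neg_one_smul] at h3
    rw [state_sub hL, hL.2.1, hL.2.2.1] at h1 h2
    constructor <;> linarith

lemma exists_extreme_state_le_zero (hQ : IsArchQuadraticModule Q) {f : A} (hf : f ∉ Q) :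
    ∃ L ∈ (stateSet Q).extremePoints ℝ, L f ≤ 0 := by
  obtain ⟨L₀, hL₀, hL₀f⟩ := hQ.exists_state_le_zero hf
  let l : StrongDual ℝ (A → ℝ) := -ContinuousLinearMap.proj (R := ℝ) (φ := fun _ : A ↦ ℝ) f
  have hl : ∀ L, l L = -L f := fun L ↦ rfl
  have hexp : IsExposed ℝ (stateSet Q) {x ∈ stateSet Q | ∀ y ∈ stateSet Q, l y ≤ l x} :=
    fun _ ↦ ⟨l, rfl⟩
  obtain ⟨z, hz, hzmax⟩ := hQ.isCompact_stateSet.exists_isMaxOn ⟨L₀, hL₀⟩ l.continuous.continuousOn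
  obtain ⟨L, hL⟩ := (hexp.isCompact hQ.isCompact_stateSet).extremePoints_nonempty
    ⟨z, hz, fun y hy ↦ hzmax hy⟩
  refine ⟨L, hexp.isExtreme.extremePoints_subset_extremePoints hL, ?_⟩
  have := hL.1.2 L₀ hL₀
  rw [hl, hl] at this
  linarith

/-- Multiplication by an element whose square is at most `1` does not increase a state on `Q`: the
sequence `L (b ^ (2 * k) * q)` is convex and bounded, hence nonincreasing. -/
lemma state_sq_mul_le (hQ : IsArchQuadraticModule Q) {L : A → ℝ} (hL : L ∈ stateSet Q) {b q : A}
    (hb : 1 - b ^ 2 ∈ Q) (hq : q ∈ Q) : L (b ^ 2 * q) ≤ L q := by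
  let u : ℕ → ℝ := fun k ↦ L (b ^ (2 * k) * q)
  have hconv : ∀ k, u (k + 1) - u k ≤ u (k + 2) - u (k + 1) := by
    intro k
    have h := hL.2.2.2 _ (hQ.sq_mul_mem (b ^ k * (1 - b ^ 2)) hq)
    have he : (b ^ k * (1 - b ^ 2)) ^ 2 * q =
        (b ^ (2 * (k + 2)) * q - b ^ (2 * (k + 1)) * q) -
          (b ^ (2 * (k + 1)) * q - b ^ (2 * k) * q) := by ring
    rw [he, state_sub hL, state_sub hL, state_sub hL] at h
    simp only [u]
    linarith
  have hpow : ∀ j : ℕ, 1 - (b ^ j) ^ 2 ∈ Q := by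
    intro j
    induction j with
    | zero => simpa using hQ.zero_mem
    | succ j ih =>
      convert! hQ.add_mem hb (hQ.sq_mul_mem b ih) using 1
      ring
  have hbdd : ∀ k, u k ≤ (L (q ^ 2) + 1) / 2 := by
    intro k
    have h1 := hL.2.2.2 _ (hQ.sq_mem (q - b ^ (2 * k)))
    have h2 := hL.2.2.2 _ (hpow (2 * k))
    have he : (q - b ^ (2 * k)) ^ 2 =
        (q ^ 2 - b ^ (2 * k) * q) + ((b ^ (2 * k)) ^ 2 - b ^ (2 * k) * q) := by ring
    rw [he, hL.1, state_sub hL, state_sub hL] at h1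
    rw [state_sub hL, hL.2.2.1] at h2
    simp only [u]
    linarith
  by_contra! hlt
  have hpos : 0 < u 1 - u 0 := by simpa [u] using hlt
  have hstep : ∀ k, u 1 - u 0 ≤ u (k + 1) - u k := by
    intro k
    induction k with
    | zero => exact le_rfl
    | succ k ih => exact ih.trans (hconv k)
  have hgrow : ∀ k : ℕ, u 0 + k * (u 1 - u 0) ≤ u k := by
    intro k
    induction k with
    | zero => simp
    | succ k ih =>
      have := hstep k
      push_cast
      linarith
  obtain ⟨k, hk⟩ := exists_nat_gt (((L (q ^ 2) + 1) / 2 - u 0) / (u 1 - u 0))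
  rw [div_lt_iff₀ hpos] at hk
  linarith [hgrow k, hbdd k]

lemma extreme_state_sq_mul (hQ : IsArchQuadraticModule Q) {L : A → ℝ}
    (hL : L ∈ (stateSet Q).extremePoints ℝ) {b : A} (hb : 1 - b ^ 2 ∈ Q)
    (h0 : 0 < L (b ^ 2)) (h1 : L (b ^ 2) < 1) (a : A) : L (b ^ 2 * a) = L (b ^ 2) * L a := by
  have hS := hL.1
  set t := L (b ^ 2) with ht
  have ht1 : 0 < 1 - t := by linarith
  have hL₁ : (fun a ↦ t⁻¹ * L (b ^ 2 * a)) ∈ stateSet Q := by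
    refine ⟨fun a c ↦ ?_, fun r a ↦ ?_, ?_, fun q hq ↦ ?_⟩
    · simp only [mul_add, hS.1]
    · simp only [mul_smul_comm, hS.2.1]; ring
    · simp only [mul_one]; exact inv_mul_cancel₀ h0.ne'
    · exact mul_nonneg (inv_nonneg.2 h0.le) (hS.2.2.2 _ (hQ.sq_mul_mem b hq))
  have hL₂ : (fun a ↦ (1 - t)⁻¹ * (L a - L (b ^ 2 * a))) ∈ stateSet Q := by
    refine ⟨fun a c ↦ ?_, fun r a ↦ ?_, ?_, fun q hq ↦ ?_⟩
    · simp only [mul_add, hS.1]; ring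
    · simp only [mul_smul_comm, hS.2.1]; ring
    · simp only [mul_one, hS.2.2.1]; exact inv_mul_cancel₀ ht1.ne'
    · exact mul_nonneg (inv_nonneg.2 ht1.le) (sub_nonneg.2 (hQ.state_sq_mul_le hS hb hq))
  have hseg : L ∈ openSegment ℝ (fun a ↦ t⁻¹ * L (b ^ 2 * a))
      (fun a ↦ (1 - t)⁻¹ * (L a - L (b ^ 2 * a))) := by
    refine ⟨t, 1 - t, h0, ht1, by ring, ?_⟩
    ext a
    simp only [Pi.add_apply, Pi.smul_apply, smul_eq_mul]
    rw [mul_inv_cancel_left₀ h0.ne', mul_inv_cancel_left₀ ht1.ne']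
    ring
  have h := congrFun (mem_extremePoints.1 hL |>.2 _ hL₁ _ hL₂ hseg).1 a
  rw [← h, mul_inv_cancel_left₀ h0.ne']

lemma state_sq_le (hQ : IsArchQuadraticModule Q) {L : A → ℝ} (hL : L ∈ stateSet Q) (a : A) :
    L a ^ 2 ≤ L (a ^ 2) := by
  have h := hL.2.2.2 _ (hQ.sq_mem (a - L a • (1 : A)))
  have he : (a - L a • (1 : A)) ^ 2 = (a ^ 2 - (2 * L a) • a) + (L a ^ 2) • (1 : A) := by
    simp only [Algebra.smul_def, map_mul, map_pow, map_ofNat]; ring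
  rw [he, hL.1, state_sub hL, hL.2.1, hL.2.1, hL.2.2.1] at h
  linarith

/-- Extreme states are multiplicative. -/
lemma extreme_state_mul (hQ : IsArchQuadraticModule Q) {L : A → ℝ}
    (hL : L ∈ (stateSet Q).extremePoints ℝ) (a p : A) : L (a * p) = L a * L p := by
  have hS := hL.1
  have small : ∀ c : A, (1 / 16 : ℝ) • (1 : A) - c ^ 2 ∈ Q →
      L p + 2 * L (c * p) + L (c ^ 2 * p) = (1 + 2 * L c + L (c ^ 2)) * L p := by
    intro c hc
    have hcc := hS.2.2.2 _ hc
    rw [state_sub hS, hS.2.1, hS.2.2.1] at hcc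
    have hc2 := hQ.state_sq_le hS c
    have hlo : -(1 / 4) ≤ L c := by nlinarith
    have hhi : L c ≤ 1 / 4 := by nlinarith
    have hexp : ∀ x : A, ((1 / 2 : ℝ) • (1 + c)) ^ 2 * x =
        (1 / 4 : ℝ) • (x + (2 : ℝ) • (c * x) + c ^ 2 * x) := by
      intro x
      rw [smul_pow, smul_mul_assoc]
      norm_num
      simp only [Algebra.smul_def, map_ofNat]
      ring
    have hu : 1 - ((1 / 2 : ℝ) • (1 + c)) ^ 2 ∈ Q := by
      have h := hQ.add_mem (hQ.add_mem (hQ.smul_mem (r := 1 / 2) (by norm_num) hc)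
        (hQ.smul_mem (r := 1 / 4) (by norm_num) (hQ.sq_mem (1 - c))))
        (hQ.smul_one_mem (r := 15 / 32) (by norm_num))
      convert! h using 1
      have := hexp 1
      rw [mul_one] at this
      rw [this, show (1 - c) ^ 2 = 1 - (2 : ℝ) • c + c ^ 2 by
        simp only [Algebra.smul_def, map_ofNat]; ring, mul_one, mul_one]
      module
    have hval : ∀ x : A, L (((1 / 2 : ℝ) • (1 + c)) ^ 2 * x) =
        1 / 4 * (L x + 2 * L (c * x) + L (c ^ 2 * x)) := by
      intro x
      rw [hexp, hS.2.1, hS.1, hS.1, hS.2.1]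
    have hval1 := hval 1
    simp only [mul_one, hS.2.2.1] at hval1
    have hc0 : 0 ≤ L (c ^ 2) := hS.2.2.2 _ (hQ.sq_mem c)
    have h := hQ.extreme_state_sq_mul hL hu (by rw [hval1]; linarith) (by rw [hval1]; linarith) p
    rw [hval, hval1] at h
    linarith
  obtain ⟨N, hN⟩ := hQ.exists_sub_sq_mem a
  obtain ⟨e, he0, heN⟩ : ∃ e : ℝ, 0 < e ∧ e ^ 2 * N ≤ 1 / 16 := by
    refine ⟨(4 * (|N| + 1))⁻¹, by positivity, ?_⟩
    rw [inv_pow, inv_mul_le_iff₀ (by positivity)]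
    nlinarith [le_abs_self N, abs_nonneg N]
  have hc : (1 / 16 : ℝ) • (1 : A) - (e • a) ^ 2 ∈ Q := by
    have h := hQ.add_mem (hQ.smul_mem (sq_nonneg e) hN)
      (hQ.smul_one_mem (r := 1 / 16 - e ^ 2 * N) (by linarith))
    convert! h using 1
    rw [smul_pow]
    module
  have h1 := small _ hc
  have h2 := small (-(e • a)) (by rwa [neg_sq])
  rw [← neg_smul] at h2
  simp only [smul_pow, neg_sq, smul_mul_assoc, hS.2.1] at h1 h2
  have : e * (L (a * p) - L a * L p) = 0 := by linarith
  rcases mul_eq_zero.1 this with h | h <;> linarith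

/-- **Representation theorem**: an element outside an Archimedean quadratic module is nonpositive
under some `ℝ`-algebra character that is nonnegative on the module. -/
theorem exists_character_le_zero (hQ : IsArchQuadraticModule Q) {f : A} (hf : f ∉ Q) :
    ∃ φ : A →ₐ[ℝ] ℝ, (∀ q ∈ Q, 0 ≤ φ q) ∧ φ f ≤ 0 := by
  obtain ⟨L, hL, hLf⟩ := hQ.exists_extreme_state_le_zero hf
  have hS := hL.1
  let l : A →ₗ[ℝ] ℝ := { toFun := L, map_add' := hS.1, map_smul' := hS.2.1 }
  exact ⟨AlgHom.ofLinearMap l hS.2.2.1 (hQ.extreme_state_mul hL), hS.2.2.2, hLf⟩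

end IsArchQuadraticModule

section Truncation

variable {σ ιg ιh : Type*} [Fintype ιg] [Fintype ιh]
  {g : ιg → MvPolynomial σ ℝ} {h : ιh → MvPolynomial σ ℝ}

lemma IsSOS.add {p q : MvPolynomial σ ℝ} (hp : IsSOS p) (hq : IsSOS q) : IsSOS (p + q) := by
  obtain ⟨k, a, rfl⟩ := hp
  obtain ⟨l, b, rfl⟩ := hq
  exact ⟨k + l, Fin.append a b, by simp [Fin.sum_univ_add]⟩

lemma IsSOS.sq_mul {p : MvPolynomial σ ℝ} (hp : IsSOS p) (a : MvPolynomial σ ℝ) :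
    IsSOS (a ^ 2 * p) := by
  obtain ⟨k, b, rfl⟩ := hp
  exact ⟨k, fun i ↦ a * b i, by simp only [mul_pow, Finset.mul_sum]⟩

lemma isSOS_zero : IsSOS (0 : MvPolynomial σ ℝ) := ⟨0, Fin.elim0, by simp⟩

lemma isSOS_one : IsSOS (1 : MvPolynomial σ ℝ) := ⟨1, fun _ ↦ 1, by simp⟩

lemma IsSOS.rename {τ : Type*} (f : σ → τ) {p : MvPolynomial σ ℝ} (hp : IsSOS p) :
    IsSOS (rename f p) := by
  obtain ⟨k, b, rfl⟩ := hp
  exact ⟨k, fun i ↦ MvPolynomial.rename f (b i), by simp only [map_sum, map_pow]⟩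

lemma InQM.add {p q : MvPolynomial σ ℝ} (hp : InQM g h p) (hq : InQM g h q) :
    InQM g h (p + q) := by
  obtain ⟨s0, s, r, hs0, hs, rfl⟩ := hp
  obtain ⟨s0', s', r', hs0', hs', rfl⟩ := hq
  refine ⟨s0 + s0', s + s', r + r', hs0.add hs0', fun j ↦ (hs j).add (hs' j), ?_⟩
  simp only [Pi.add_apply, mul_add, Finset.sum_add_distrib]
  ring

lemma InQM.sq_mul {p : MvPolynomial σ ℝ} (hp : InQM g h p) (a : MvPolynomial σ ℝ) :
    InQM g h (a ^ 2 * p) := by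
  obtain ⟨s0, s, r, hs0, hs, rfl⟩ := hp
  refine ⟨a ^ 2 * s0, fun j ↦ a ^ 2 * s j, fun j ↦ a ^ 2 * r j, hs0.sq_mul a,
    fun j ↦ (hs j).sq_mul a, ?_⟩
  simp only [mul_add, Finset.mul_sum, mul_left_comm]

lemma IsSOS.inQM {p : MvPolynomial σ ℝ} (hp : IsSOS p) : InQM g h p :=
  ⟨p, 0, 0, hp, fun _ ↦ isSOS_zero, by simp⟩

lemma inQM_ineq [DecidableEq ιg] (j : ιg) : InQM g h (g j) := by
  refine ⟨0, Pi.single j 1, 0, isSOS_zero, fun i ↦ ?_, by simp [Pi.single_apply]⟩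
  rcases eq_or_ne i j with rfl | hij
  · simpa using isSOS_one
  · simpa [hij] using isSOS_zero

lemma inQM_eq_mul [DecidableEq ιh] (j : ιh) (q : MvPolynomial σ ℝ) : InQM g h (h j * q) :=
  ⟨0, 0, Pi.single j q, isSOS_zero, fun _ ↦ isSOS_zero, by simp [Pi.single_apply]⟩

/-- Every element of the quadratic module lies in one of its truncations. -/
lemma InQM.exists_inQMdeg {p : MvPolynomial σ ℝ} (hp : InQM g h p) : ∃ ℓ, InQMdeg ℓ g h p := by
  obtain ⟨s0, s, q, hs0, hs, hpe⟩ := hp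
  refine ⟨s0.totalDegree + ∑ j, (s j).totalDegree + ∑ j, (q j).totalDegree, s0, s, q, hs0, hs,
    by omega, fun j ↦ ?_, fun j ↦ ?_, hpe⟩
  · have := Finset.single_le_sum (f := fun j ↦ (s j).totalDegree) (fun _ _ ↦ Nat.zero_le _)
      (Finset.mem_univ j)
    omega
  · have := Finset.single_le_sum (f := fun j ↦ (q j).totalDegree) (fun _ _ ↦ Nat.zero_le _)
      (Finset.mem_univ j)
    omega

lemma isArchQuadraticModule_setOf_inQM [Fintype σ]
    (hA : ∃ N : ℝ, InQM g h (C N - ∑ i, X i ^ 2)) :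
    IsArchQuadraticModule {p | InQM g h p} where
  add_mem := InQM.add
  sq_mul_mem a _ hb := hb.sq_mul a
  one_mem := isSOS_one.inQM
  exists_sub_sq_mem a := by
    classical
    have hsq : ∀ b : MvPolynomial σ ℝ, InQM g h (b ^ 2) := fun b ↦ by
      simpa using (isSOS_one.inQM (g := g) (h := h)).sq_mul b
    have hsm : ∀ {r : ℝ} {p}, 0 ≤ r → InQM g h p → InQM g h (C r * p) := by
      intro r p hr hp
      have := hp.sq_mul (C √r)
      rwa [← C_pow, Real.sq_sqrt hr] at this
    have hC : ∀ {r : ℝ}, 0 ≤ r → InQM g h (C r) := fun {r} hr ↦ by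
      simpa using hsm hr isSOS_one.inQM
    suffices H : ∃ N : ℝ, 0 ≤ N ∧ InQM g h (C N - a ^ 2) by
      obtain ⟨N, -, hN⟩ := H
      exact ⟨N, by simpa [smul_eq_C_mul] using hN⟩
    induction a using MvPolynomial.induction_on with
    | C r => exact ⟨r ^ 2, sq_nonneg r, by simpa using isSOS_zero.inQM⟩
    | add p q hp hq =>
      obtain ⟨N, hN0, hN⟩ := hp
      obtain ⟨M, hM0, hM⟩ := hq
      refine ⟨2 * N + 2 * M, by positivity, ?_⟩
      convert! ((hsm zero_le_two hN).add (hsm zero_le_two hM)).add (hsq (p - q)) using 1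
      simp only [map_add, map_mul, map_ofNat]
      ring
    | mul_X p i hp =>
      obtain ⟨N, hN0, hN⟩ := hp
      obtain ⟨M, hM⟩ := hA
      have hX : InQM g h (C |M| - X i ^ 2) := by
        have hsum : InQM g h (∑ j ∈ univ.erase i, X j ^ 2) :=
          Finset.sum_induction _ _ (fun _ _ ↦ InQM.add) isSOS_zero.inQM fun j _ ↦ hsq _
        convert! (hM.add hsum).add (hC (sub_nonneg.2 (le_abs_self M))) using 1
        rw [← Finset.add_sum_erase _ _ (Finset.mem_univ i), map_sub]
        ring
      refine ⟨|M| * N, by positivity, ?_⟩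
      convert! (hsm (abs_nonneg M) hN).add (hX.sq_mul p) using 1
      rw [map_mul]
      ring

/-- **Putinar's Positivstellensatz**, contrapositive form: a polynomial outside an Archimedean
quadratic module is nonpositive somewhere on the associated basic semialgebraic set. -/
theorem exists_eval_le_zero_of_not_inQM [Fintype σ]
    (hA : ∃ N : ℝ, InQM g h (C N - ∑ i, X i ^ 2)) {p : MvPolynomial σ ℝ} (hp : ¬ InQM g h p) :
    ∃ z : σ → ℝ, (∀ j, 0 ≤ eval z (g j)) ∧ (∀ j, eval z (h j) = 0) ∧ eval z p ≤ 0 := by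
  classical
  obtain ⟨φ, hφ, hφp⟩ := (isArchQuadraticModule_setOf_inQM hA).exists_character_le_zero hp
  have heval : ∀ q, φ q = eval (fun i ↦ φ (X i)) q := fun q ↦ by
    rw [← aeval_eq_eval]
    exact DFunLike.congr_fun (aeval_unique φ) q
  refine ⟨fun i ↦ φ (X i), fun j ↦ ?_, fun j ↦ ?_, ?_⟩
  · rw [← heval]; exact hφ _ (inQM_ineq j)
  · rw [← heval]
    have h1 := hφ _ (inQM_eq_mul j 1)
    have h2 := hφ _ (inQM_eq_mul j (-1))
    rw [mul_one] at h1
    rw [mul_neg, mul_one, map_neg] at h2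
    linarith
  · rwa [← heval]

end Truncation

lemma exists_inQM_lift {m mg mh : ℕ} {g : Fin mg → MvPolynomial (Fin m) ℝ}
    {h : Fin mh → MvPolynomial (Fin m) ℝ} {τ : Type*} [Fintype τ]
    (hA : ∃ N : ℕ, InQM g h (C (N : ℝ) - ∑ i, X i ^ 2)) :
    ∃ N : ℝ, InQM (liftIneq τ g) (liftEq τ h) (C N - ∑ i, X i ^ 2) := by
  obtain ⟨N, s0, s, q, hs0, hs, he⟩ := hA
  refine ⟨N + 1, rename Sum.inl s0, fun j ↦ rename Sum.inl (s j),
    Sum.elim (fun j ↦ rename Sum.inl (q j)) 1, hs0.rename _, fun j ↦ (hs j).rename _, ?_⟩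
  have he' := congrArg (rename (Sum.inl : Fin m → Fin m ⊕ τ)) he
  simp only [map_sub, map_add, map_sum, map_mul, map_pow, rename_C, rename_X] at he'
  simp only [liftIneq, liftEq, Fintype.sum_sum_type, Sum.elim_inl, Sum.elim_inr, Pi.one_apply,
    Finset.univ_unique, Finset.sum_singleton, mul_one, map_add, map_one]
  linear_combination he'

lemma eval_sjFormPoly {m n : ℕ} (π : Fin m → Fin n) (u : Fin n → MvPolynomial (Fin m) ℝ)
    (z : Fin m ⊕ Fin m → ℝ) :
    eval z (sjFormPoly π u) = sjForm π u (z ∘ Sum.inl) (z ∘ Sum.inr) := by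
  simp [sjFormPoly, sjForm, eval_rename]

lemma sjForm_add {m n : ℕ} (π : Fin m → Fin n) (u v : Fin n → MvPolynomial (Fin m) ℝ)
    (x y : Fin m → ℝ) : sjForm π (u + v) x y = sjForm π u x y + sjForm π v x y := by
  simp only [sjForm, sjac, pseudoGrad, Pi.add_apply, map_add, map_mul, ← Finset.sum_add_distrib]
  refine Finset.sum_congr rfl fun j _ ↦ Finset.sum_congr rfl fun k _ ↦ ?_
  ring

lemma sjForm_smul {m n : ℕ} (π : Fin m → Fin n) (r : ℝ) (u : Fin n → MvPolynomial (Fin m) ℝ)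
    (x y : Fin m → ℝ) : sjForm π (r • u) x y = r * sjForm π u x y := by
  simp only [sjForm, sjac, pseudoGrad, Pi.smul_apply, Derivation.map_smul, map_add, map_mul,
    smul_eval,
    Finset.mul_sum]
  refine Finset.sum_congr rfl fun j _ ↦ Finset.sum_congr rfl fun k _ ↦ ?_
  ring

lemma sjForm_sum_sq {m n : ℕ} (π : Fin m → Fin n) (x y : Fin m → ℝ) :
    sjForm π (fun _ ↦ ∑ j, X j ^ 2) x y = 2 * ∑ j, y j ^ 2 := by
  have hp : ∀ j k : Fin m, eval x (pderiv k (pderiv j (∑ i, X i ^ 2 : MvPolynomial (Fin m) ℝ))) =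
      if j = k then 2 else 0 := by
    intro j k
    have h1 : pderiv j (∑ i, X i ^ 2 : MvPolynomial (Fin m) ℝ) = C 2 * X j := by
      simp [pderiv_X, Pi.single_apply, Derivation.leibniz_pow, two_mul,
        show (C 2 : MvPolynomial (Fin m) ℝ) = 2 from rfl]
    rw [h1, pderiv_C_mul]
    simp [pderiv_X, Pi.single_apply]
    split_ifs <;> simp
  simp only [sjForm, sjac, pseudoGrad, map_mul, map_add, hp, eval_C, Finset.mul_sum]
  refine Finset.sum_congr rfl fun j _ ↦ ?_
  rw [Finset.sum_eq_single j (fun k _ hk ↦ by simp [hk, hk.symm]) (by simp)]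
  norm_num
  ring

lemma payoffOf_add {m d : ℕ} (c c' : ExpIdx m d → ℝ) :
    payoffOf d (c + c') = payoffOf d c + payoffOf d c' := by
  simp only [payoffOf, Pi.add_apply, map_add, add_mul, Finset.sum_add_distrib]

lemma payoffOf_smul {m d : ℕ} (r : ℝ) (c : ExpIdx m d → ℝ) :
    payoffOf d (r • c) = r • payoffOf d c := by
  simp only [payoffOf, Pi.smul_apply, smul_eq_mul, map_mul, mul_assoc, Finset.smul_sum,
    smul_eq_C_mul]

lemma exists_payoffOf_eq_sum_sq (m : ℕ) {d : ℕ} (hd : 2 ≤ d) :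
    ∃ c : ExpIdx m d → ℝ, payoffOf d c = ∑ j, X j ^ 2 := by
  classical
  let idx : Fin m → ExpIdx m d := fun j ↦
    ⟨fun k ↦ if k = j then ⟨2, by omega⟩ else 0, by simpa [apply_ite] using hd⟩
  have hidx : ∀ j, payoffOf d (Pi.single (idx j) (1 : ℝ)) = X j ^ 2 := by
    intro j
    rw [payoffOf, Finset.sum_eq_single (idx j) (fun e _ he ↦ by simp [he]) (by simp)]
    rw [Finset.prod_eq_single j (fun k _ hk ↦ by simp [idx, hk]) (by simp)]
    simp [idx]
  let P : (ExpIdx m d → ℝ) →ₗ[ℝ] MvPolynomial (Fin m) ℝ :=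
    { toFun := payoffOf d, map_add' := payoffOf_add, map_smul' := payoffOf_smul }
  exact ⟨∑ j, Pi.single (idx j) 1, (map_sum P _ _).trans (Finset.sum_congr rfl fun j _ ↦ hidx j)⟩

/-- The quadratic form of the symmetrized Jacobian at `(x, y)` as a linear functional of the
coefficient vectors. -/
def sjFormCoeff {m n : ℕ} (d : ℕ) (π : Fin m → Fin n) (x y : Fin m → ℝ) :
    (Fin n → ExpIdx m d → ℝ) →ₗ[ℝ] ℝ where
  toFun c := sjForm π (fun i ↦ payoffOf d (c i)) x y
  map_add' c c' := by
    rw [← sjForm_add]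
    congr 1
    exact funext fun i ↦ payoffOf_add (c i) (c' i)
  map_smul' r c := by
    rw [RingHom.id_apply, smul_eq_mul, ← sjForm_smul]
    congr 1
    exact funext fun i ↦ payoffOf_smul r (c i)

/-- The coefficient vectors of the games that are monotone over `S`. -/
def monotoneGames {m n : ℕ} (d : ℕ) (π : Fin m → Fin n) (S : Set (Fin m → ℝ)) :
    Set (Fin n → ExpIdx m d → ℝ) :=
  {c | ∀ x ∈ S, ∀ y, sjFormCoeff d π x y c ≤ 0}

lemma convex_monotoneGames {m n : ℕ} (d : ℕ) (π : Fin m → Fin n) (S : Set (Fin m → ℝ)) :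
    Convex ℝ (monotoneGames d π S) := by
  intro c hc c' hc' a b ha hb _ x hx y
  rw [map_add, map_smul, map_smul]
  exact add_nonpos (mul_nonpos_of_nonneg_of_nonpos ha (hc x hx y))
    (mul_nonpos_of_nonneg_of_nonpos hb (hc' x hx y))

/-- On the interior of the set of monotone games, the symmetrized Jacobian is negative definite. -/
lemma sjFormCoeff_neg_of_mem_interior {m n d : ℕ} (hd : 2 ≤ d) (π : Fin m → Fin n)
    {S : Set (Fin m → ℝ)} {c : Fin n → ExpIdx m d → ℝ} (hc : c ∈ interior (monotoneGames d π S))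
    {x y : Fin m → ℝ} (hx : x ∈ S) (hy : 0 < ∑ j, y j ^ 2) : sjFormCoeff d π x y c < 0 := by
  obtain ⟨e, he⟩ := exists_payoffOf_eq_sum_sq m hd
  have hcont : Filter.Tendsto (fun t : ℝ ↦ c + t • fun _ : Fin n ↦ e) (nhdsWithin 0 (Set.Ioi 0))
      (nhds c) := by
    have : Continuous fun t : ℝ ↦ c + t • fun _ : Fin n ↦ e := by fun_prop
    simpa using (this.tendsto 0).mono_left nhdsWithin_le_nhds
  obtain ⟨t, ht, ht0⟩ := ((hcont.eventually (mem_interior_iff_mem_nhds.1 hc)).and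
    self_mem_nhdsWithin).exists
  have h := ht x hx y
  have he' : sjFormCoeff d π x y (fun _ : Fin n ↦ e) = 2 * ∑ j, y j ^ 2 := by
    rw [← sjForm_sum_sq π x y, ← he]
    rfl
  rw [map_add, map_smul, he', smul_eq_mul] at h
  have := mul_pos (Set.mem_Ioi.1 ht0) hy
  linarith

open MeasureTheory in
/-- For `d ≥ 2` and a compact basic semialgebraic set `X` whose quadratic
module is Archimedean, identifying degree-`d` `n`-player polynomial games over `X` with
their coefficient vectors, the set of games that are monotone over `X` but not SOS-monotone
(no level `ℓ` with `−yᵀ SJ_G(x) y ∈ Q_ℓ(X × B)`) has Lebesgue measure zero. -/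
theorem monotone_not_sos_monotone_measure_zero {m n mg mh : ℕ} (d : ℕ) (hd : 2 ≤ d)
    (π : Fin m → Fin n)
    (g : Fin mg → MvPolynomial (Fin m) ℝ) (h : Fin mh → MvPolynomial (Fin m) ℝ)
    (hX : IsCompact (semialgSet g h))
    (hArch : ∃ N : ℕ, InQM g h (C (N : ℝ) - ∑ i, X i ^ 2)) :
    volume {c : Fin n → ExpIdx m d → ℝ |
      (∀ x ∈ semialgSet g h, ∀ y : Fin m → ℝ,
          sjForm π (fun i => payoffOf d (c i)) x y ≤ 0) ∧
      ¬ ∃ ℓ : ℕ, InQMdeg ℓ (liftIneq (Fin m) g) (liftEq (Fin m) h)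
          (- sjFormPoly π (fun i => payoffOf d (c i)))} = 0 := by
  refine measure_mono_null ?_ ((convex_monotoneGames d π (semialgSet g h)).addHaar_frontier volume)
  rintro c ⟨hmono, hsos⟩
  refine ⟨subset_closure hmono, fun hc_int ↦ hsos (InQM.exists_inQMdeg ?_)⟩
  by_contra hnot
  obtain ⟨z, hzg, hzh, hz⟩ := exists_eval_le_zero_of_not_inQM (exists_inQM_lift hArch) hnot
  have hx : z ∘ Sum.inl ∈ semialgSet g h :=
    ⟨fun j ↦ by simpa [liftIneq, eval_rename] using hzg j,
      fun j ↦ by simpa [liftEq, eval_rename] using hzh (Sum.inl j)⟩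
  have hy : ∑ j, (z ∘ Sum.inr) j ^ 2 = 1 := by
    have := hzh (Sum.inr ())
    simp only [liftEq, Sum.elim_inr, map_sub, map_one, map_sum, map_pow, eval_X] at this
    simp only [Function.comp_apply]
    linarith
  have hneg := sjFormCoeff_neg_of_mem_interior hd π hc_int hx (y := z ∘ Sum.inr)
    (by rw [hy]; exact one_pos)
  rw [map_neg, eval_sjFormPoly] at hz
  have : sjFormCoeff d π (z ∘ Sum.inl) (z ∘ Sum.inr) c =
    sjForm π (fun i ↦ payoffOf d (c i)) (z ∘ Sum.inl) (z ∘ Sum.inr) := rfl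
  linarith

end
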